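/- Let G=(V,E) be a finite simple graph in which every vertex has degree at least 1, and suppose φ_G ≥ φ for some φ > 0. Then for every vertex v ∈ V and every integer t ≥ 0, the row vector p_v^t = 1_v W^t satisfies ‖p_v^t D^{−1/2}‖_2² ≤ 1/μ_G + (1 − φ²/4)^{2t}. -/

import Mathlib

open scoped Classical
open Matrix

noncomputable section

namespace Sublinear

variable {V : Type*}

/-- The degree `d(v)` of a vertex, as a real number. -/
def deg [Fintype V] (G : SimpleGraph V) (v : V) : ℝ :=
  ((Finset.univ.filter fun u => G.Adj v u).card : ℝ)

/-- The volume `μ_G(S)` of a set of vertices. -/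
def vol [Fintype V] (G : SimpleGraph V) (S : Set V) : ℝ :=
  ∑ v ∈ Finset.univ.filter (fun v => v ∈ S), deg G v

/-- The number of ordered adjacent pairs `(u,v)` with `u ∈ S`, `v ∈ T`.
For disjoint `S`, `T` this equals the number `e_G(S,T)` of edges between `S` and `T`. -/
def eB [Fintype V] (G : SimpleGraph V) (S T : Set V) : ℝ :=
  (((Finset.univ : Finset (V × V)).filter
      fun p => p.1 ∈ S ∧ p.2 ∈ T ∧ G.Adj p.1 p.2).card : ℝ)

/-- The number `e_G(S)` of edges with both endpoints in `S`. -/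
def eIn [Fintype V] (G : SimpleGraph V) (S : Set V) : ℝ := eB G S S / 2

/-- The conductance `φ_G(S)` of a set of vertices. -/
def cond [Fintype V] (G : SimpleGraph V) (S : Set V) : ℝ :=
  eB G S Sᶜ / vol G S

/-- The conductance `φ_G` of the graph: the minimum of `φ_G(S)` over nonempty `S`
with `μ_G(S) ≤ μ_G/2`. -/
def conductance [Fintype V] (G : SimpleGraph V) : ℝ :=
  sInf {x | ∃ S : Set V, S.Nonempty ∧ vol G S ≤ vol G Set.univ / 2 ∧ x = cond G S}

/-- The adjacency matrix `A` of `G`, with real entries. -/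
def adjMat [Fintype V] (G : SimpleGraph V) : Matrix V V ℝ :=
  Matrix.of fun u v => if G.Adj u v then (1 : ℝ) else 0

/-- The diagonal matrix `D⁻¹` of inverse degrees. -/
def degInv [Fintype V] [DecidableEq V] (G : SimpleGraph V) : Matrix V V ℝ :=
  Matrix.diagonal fun v => (deg G v)⁻¹

/-- The diagonal matrix `D^{-1/2}` of inverse square roots of degrees. -/
def degInvSqrt [Fintype V] [DecidableEq V] (G : SimpleGraph V) : Matrix V V ℝ :=
  Matrix.diagonal fun v => (Real.sqrt (deg G v))⁻¹

/-- The normalized Laplacian `𝓛 = I - D^{-1/2} A D^{-1/2}` of `G`. -/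
def normLap [Fintype V] [DecidableEq V] (G : SimpleGraph V) : Matrix V V ℝ :=
  1 - degInvSqrt G * adjMat G * degInvSqrt G

/-- The lazy random walk matrix `W = (I + D⁻¹ A)/2` of `G`. -/
def lazyW [Fintype V] [DecidableEq V] (G : SimpleGraph V) : Matrix V V ℝ :=
  ((1 : ℝ) / 2) • (1 + degInv G * adjMat G)

/-- The matrix `M = I - W = (I - D⁻¹ A)/2`. -/
def walkM [Fintype V] [DecidableEq V] (G : SimpleGraph V) : Matrix V V ℝ :=
  ((1 : ℝ) / 2) • (1 - degInv G * adjMat G)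

/-- The indicator row vector `1_v` of a vertex `v`. -/
def indVec (v : V) : V → ℝ := fun u => if u = v then 1 else 0

/-- `t` is an eigenvalue of the matrix `M`. -/
def IsEigenvalue [Fintype V] (M : Matrix V V ℝ) (t : ℝ) : Prop :=
  ∃ x : V → ℝ, x ≠ 0 ∧ M *ᵥ x = t • x

section WeightedGraph

variable {V : Type*} [Fintype V] {a : V → V → ℝ} {d : V → ℝ} {φ : ℝ}

/-- The symmetrization of a row sum against a symmetric weight. -/
theorem sum_weight_mul_left_add_right (ha : ∀ u w, a u w = a w u)
    (hd : ∀ u, d u = ∑ w, a u w) (f : V → ℝ) :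
    ∑ u, ∑ w, a u w * (f u + f w) = 2 * ∑ u, d u * f u := by
  have h1 : ∑ u, ∑ w, a u w * f u = ∑ u, d u * f u := by
    simp only [hd, Finset.sum_mul]
  have h2 : ∑ u, ∑ w, a u w * f w = ∑ u, d u * f u := by
    rw [Finset.sum_comm, ← h1]
    exact Finset.sum_congr rfl fun u _ => Finset.sum_congr rfl fun w _ => by rw [ha]
  simp only [mul_add, Finset.sum_add_distrib, h1, h2]
  ring

theorem sum_weight_mul_cross_comm (ha : ∀ u w, a u w = a w u) (f g : V → ℝ) :
    ∑ u, ∑ w, a u w * (f w * g u) = ∑ u, ∑ w, a u w * (f u * g w) := by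
  rw [Finset.sum_comm]
  exact Finset.sum_congr rfl fun u _ => Finset.sum_congr rfl fun w _ => by rw [ha]

theorem sum_weight_add_mul_add (ha : ∀ u w, a u w = a w u)
    (hd : ∀ u, d u = ∑ w, a u w) (f g : V → ℝ) :
    ∑ u, ∑ w, a u w * ((f u + f w) * (g u + g w))
      = 2 * ∑ u, d u * (f u * g u) + 2 * ∑ u, ∑ w, a u w * (f u * g w) := by
  have h := sum_weight_mul_left_add_right ha hd fun u => f u * g u
  have h2 := sum_weight_mul_cross_comm ha f g
  rw [← h, two_mul (∑ u, ∑ w, a u w * (f u * g w))]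
  nth_rewrite 1 [← h2]
  simp only [← Finset.sum_add_distrib]
  exact Finset.sum_congr rfl fun u _ => Finset.sum_congr rfl fun w _ => by ring

theorem sum_weight_sub_sq (ha : ∀ u w, a u w = a w u)
    (hd : ∀ u, d u = ∑ w, a u w) (f : V → ℝ) :
    ∑ u, ∑ w, a u w * (f u - f w) ^ 2 + ∑ u, ∑ w, a u w * (f u + f w) ^ 2
      = 4 * ∑ u, d u * f u ^ 2 := by
  have h := sum_weight_mul_left_add_right ha hd fun u => f u ^ 2
  have e : 4 * ∑ u, d u * f u ^ 2 = 2 * (2 * ∑ u, d u * f u ^ 2) := by ring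
  rw [e, ← h]
  simp only [← Finset.sum_add_distrib, Finset.mul_sum]
  exact Finset.sum_congr rfl fun u _ => Finset.sum_congr rfl fun w _ => by ring

/-- Cauchy-Schwarz for weighted double sums. -/
theorem sq_sum_weight_mul_le (hpos : ∀ u w, 0 ≤ a u w) (p q : V → V → ℝ) :
    (∑ u, ∑ w, a u w * (p u w * q u w)) ^ 2
      ≤ (∑ u, ∑ w, a u w * p u w ^ 2) * ∑ u, ∑ w, a u w * q u w ^ 2 := by
  simp only [← Fintype.sum_prod_type']
  refine Finset.sum_sq_le_sum_mul_sum_of_sq_le_mul _ (fun x _ => ?_) (fun x _ => ?_)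
    (fun x _ => ?_)
  · exact mul_nonneg (hpos _ _) (sq_nonneg _)
  · exact mul_nonneg (hpos _ _) (sq_nonneg _)
  · exact le_of_eq (by ring)

/-- The discrete coarea inequality: a nonnegative function whose support has at most half of
the volume has large total variation. -/
theorem conductance_mul_sum_le_total_variation (ha : ∀ u w, a u w = a w u)
    (hpos : ∀ u w, 0 ≤ a u w) (hd : ∀ u, d u = ∑ w, a u w)
    (hcut : ∀ S : Finset V, ∑ u ∈ S, d u ≤ (∑ u, d u) / 2 →
      φ * ∑ u ∈ S, d u ≤ ∑ u ∈ S, ∑ w ∈ Sᶜ, a u w)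
    (F : V → ℝ) (hF : ∀ u, 0 ≤ F u)
    (hsupp : ∑ u with 0 < F u, d u ≤ (∑ u, d u) / 2) :
    2 * φ * ∑ u, d u * F u ≤ ∑ u, ∑ w, a u w * |F u - F w| := by
  induction hn : (Finset.univ.filter fun u => 0 < F u).card using Nat.strong_induction_on
    generalizing F with
  | _ n ih =>
  have hd0 : ∀ u, 0 ≤ d u := fun u => by
    rw [hd]; exact Finset.sum_nonneg fun w _ => hpos u w
  set S := Finset.univ.filter fun u => 0 < F u with hS
  have memS : ∀ u, u ∈ S ↔ 0 < F u := fun u => by simp [hS]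
  rcases S.eq_empty_or_nonempty with hemp | hne
  · have hz : ∀ u, F u = 0 := fun u => by
      refine le_antisymm (not_lt.1 fun h => ?_) (hF u)
      simpa [hemp] using (memS u).2 h
    simp [hz]
  obtain ⟨x, hxS, hx⟩ := S.exists_min_image F hne
  have hm : 0 < F x := (memS x).1 hxS
  set m := F x with hmdef
  set χ : V → ℝ := fun u => if u ∈ S then 1 else 0 with hχ
  set F' : V → ℝ := fun u => F u - m * χ u with hF'
  have in_S : ∀ u, u ∈ S → χ u = 1 ∧ m ≤ F u := fun u hu => ⟨by simp [hχ, hu], hx u hu⟩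
  have out_S : ∀ u, u ∉ S → χ u = 0 ∧ F u = 0 := fun u hu =>
    ⟨by simp [hχ, hu], le_antisymm (not_lt.1 fun h => hu ((memS u).2 h)) (hF u)⟩
  have hF'0 : ∀ u, 0 ≤ F' u := fun u => by
    by_cases hu : u ∈ S
    · obtain ⟨h1, h2⟩ := in_S u hu
      simp only [hF', h1]; linarith
    · obtain ⟨h1, h2⟩ := out_S u hu
      simp [hF', h1, h2]
  have hsub : (Finset.univ.filter fun u => 0 < F' u) ⊆ S.erase x := by
    intro u hu
    have hu' : 0 < F' u := by simpa using hu
    rw [Finset.mem_erase]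
    constructor
    · rintro rfl
      simp [hF', (in_S u hxS).1, ← hmdef] at hu'
    · by_contra hn
      obtain ⟨h1, h2⟩ := out_S u hn
      simp [hF', h1, h2] at hu'
  have hcard : (Finset.univ.filter fun u => 0 < F' u).card < n := by
    rw [← hn]
    exact (Finset.card_le_card hsub).trans_lt (Finset.card_erase_lt_of_mem hxS)
  have hIH := ih _ hcard F' hF'0
    ((Finset.sum_le_sum_of_subset_of_nonneg (hsub.trans (Finset.erase_subset _ _))
      fun u _ _ => hd0 u).trans hsupp) rfl
  have hcutS := hcut S hsupp
  have habs : ∀ u w, |F u - F w|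
      = |F' u - F' w| + m * (χ u * (1 - χ w) + (1 - χ u) * χ w) := by
    intro u w
    by_cases hu : u ∈ S <;> by_cases hw : w ∈ S
    · simp [hF', (in_S u hu).1, (in_S w hw).1]
    · obtain ⟨h1, h2⟩ := in_S u hu
      obtain ⟨h3, h4⟩ := out_S w hw
      simp only [hF', h1, h3, h4]
      rw [abs_of_nonneg (by linarith), abs_of_nonneg (by linarith)]
      ring
    · obtain ⟨h1, h2⟩ := out_S u hu
      obtain ⟨h3, h4⟩ := in_S w hw
      simp only [hF', h1, h3, h2]
      rw [abs_of_nonpos (by linarith), abs_of_nonpos (by linarith)]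
      ring
    · obtain ⟨h1, h2⟩ := out_S u hu
      obtain ⟨h3, h4⟩ := out_S w hw
      simp [hF', h1, h2, h3, h4]
  have hcutχ : ∑ u, ∑ w, a u w * (χ u * (1 - χ w)) = ∑ u ∈ S, ∑ w ∈ Sᶜ, a u w := by
    rw [← Finset.sum_subset (Finset.subset_univ S)
      (fun u _ hu => by simp [(out_S u hu).1])]
    refine Finset.sum_congr rfl fun u hu => ?_
    rw [← Finset.sum_subset (Finset.subset_univ Sᶜ)
      (fun w _ hw => by simp [(in_S w (by simpa using hw)).1])]
    exact Finset.sum_congr rfl fun w hw => by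
      simp [(in_S u hu).1, (out_S w (by simpa using hw)).1]
  have hcutχ' : ∑ u, ∑ w, a u w * ((1 - χ u) * χ w) = ∑ u ∈ S, ∑ w ∈ Sᶜ, a u w := by
    rw [← hcutχ, ← sum_weight_mul_cross_comm ha χ fun u => 1 - χ u]
    exact Finset.sum_congr rfl fun u _ => Finset.sum_congr rfl fun w _ => by ring
  have hTV : ∑ u, ∑ w, a u w * |F u - F w|
      = ∑ u, ∑ w, a u w * |F' u - F' w| + m * (2 * ∑ u ∈ S, ∑ w ∈ Sᶜ, a u w) := by
    rw [two_mul]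
    nth_rewrite 1 [← hcutχ]
    rw [← hcutχ']
    simp only [Finset.mul_sum, ← Finset.sum_add_distrib, habs]
    exact Finset.sum_congr rfl fun u _ => Finset.sum_congr rfl fun w _ => by ring
  have hvol : ∑ u, d u * F u = ∑ u, d u * F' u + m * ∑ u ∈ S, d u := by
    rw [← Finset.sum_subset (Finset.subset_univ S) (f := fun u => d u * F u)
        (fun u _ hu => by simp [(out_S u hu).2]),
      ← Finset.sum_subset (Finset.subset_univ S) (f := fun u => d u * F' u)
        (fun u _ hu => by simp [hF', out_S u hu]),
      Finset.mul_sum, ← Finset.sum_add_distrib]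
    exact Finset.sum_congr rfl fun u hu => by simp only [hF', (in_S u hu).1]; ring
  rw [hTV, hvol]
  nlinarith [mul_le_mul_of_nonneg_left hcutS hm.le]

/-- Cheeger's inequality for a nonnegative function supported on at most half of the volume. -/
theorem cheeger_of_nonneg (hφ : 0 ≤ φ) (ha : ∀ u w, a u w = a w u)
    (hpos : ∀ u w, 0 ≤ a u w) (hd : ∀ u, d u = ∑ w, a u w)
    (hcut : ∀ S : Finset V, ∑ u ∈ S, d u ≤ (∑ u, d u) / 2 →
      φ * ∑ u ∈ S, d u ≤ ∑ u ∈ S, ∑ w ∈ Sᶜ, a u w)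
    (f : V → ℝ) (hf : ∀ u, 0 ≤ f u)
    (hsupp : ∑ u with 0 < f u, d u ≤ (∑ u, d u) / 2) :
    φ ^ 2 * ∑ u, d u * f u ^ 2 ≤ ∑ u, ∑ w, a u w * (f u - f w) ^ 2 := by
  have hd0 : ∀ u, 0 ≤ d u := fun u => by
    rw [hd]; exact Finset.sum_nonneg fun w _ => hpos u w
  have hpow : ∀ u, 0 < f u ^ 2 ↔ 0 < f u := fun u =>
    ⟨fun h => (hf u).lt_of_ne fun h0 => by simp [← h0] at h, fun h => by positivity⟩
  have hTV := conductance_mul_sum_le_total_variation ha hpos hd hcut (fun u => f u ^ 2)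
    (fun u => sq_nonneg _) (by simpa only [hpow] using hsupp)
  have habs : ∀ u w, |f u ^ 2 - f w ^ 2| = |f u - f w| * (f u + f w) := fun u w => by
    rw [sq_sub_sq, abs_mul, abs_of_nonneg (add_nonneg (hf u) (hf w)), mul_comm]
  simp only [habs] at hTV
  have hCS := sq_sum_weight_mul_le hpos (fun u w => |f u - f w|) (fun u w => f u + f w)
  simp only [sq_abs] at hCS
  have hE := sum_weight_sub_sq ha hd f
  set N := ∑ u, d u * f u ^ 2
  set E := ∑ u, ∑ w, a u w * (f u - f w) ^ 2
  have hN : 0 ≤ N := Finset.sum_nonneg fun u _ => mul_nonneg (hd0 u) (sq_nonneg _)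
  have hE0 : 0 ≤ E := Finset.sum_nonneg fun u _ => Finset.sum_nonneg fun w _ =>
    mul_nonneg (hpos u w) (sq_nonneg _)
  have hsq := (pow_le_pow_left₀ (by positivity) hTV 2).trans hCS
  rcases hN.eq_or_lt with h0 | h0
  · simpa [← h0] using hE0
  · refine le_of_mul_le_mul_right ?_ h0
    nlinarith [mul_nonneg hE0 hE0]

/-- A weighted median of a real function. -/
theorem exists_weighted_median [Nonempty V] (hd0 : ∀ u, 0 ≤ d u) (f : V → ℝ) :
    ∃ c, ∑ u with c < f u, d u ≤ (∑ u, d u) / 2 ∧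
      ∑ u with f u < c, d u ≤ (∑ u, d u) / 2 := by
  have htot : 0 ≤ ∑ u, d u := Finset.sum_nonneg fun u _ => hd0 u
  obtain ⟨x, -, hx⟩ := Finset.univ.exists_max_image f Finset.univ_nonempty
  have hne : (Finset.univ.filter fun v =>
      ∑ u with f v < f u, d u ≤ (∑ u, d u) / 2).Nonempty := by
    refine ⟨x, ?_⟩
    rw [Finset.mem_filter, Finset.filter_false_of_mem fun u hu => not_lt.2 (hx u hu)]
    exact ⟨Finset.mem_univ _, by simp only [Finset.sum_empty]; positivity⟩
  obtain ⟨v, hv, hmin⟩ := Finset.exists_min_image _ f hne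
  refine ⟨f v, (Finset.mem_filter.1 hv).2, not_lt.1 fun hlt => ?_⟩
  have hne' : (Finset.univ.filter fun u => f u < f v).Nonempty := by
    by_contra h
    rw [Finset.not_nonempty_iff_eq_empty.1 h] at hlt
    simp only [Finset.sum_empty] at hlt
    linarith
  obtain ⟨w, hw, hmax⟩ := Finset.exists_max_image _ f hne'
  have hwv : f w < f v := (Finset.mem_filter.1 hw).2
  have hset : (Finset.univ.filter fun u => f w < f u)
      ⊆ Finset.univ.filter fun u => ¬ f u < f v := by
    intro u hu
    simp only [Finset.mem_filter, Finset.mem_univ, true_and] at hu hmax ⊢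
    exact fun h => absurd (hmax u h) (not_le.2 hu)
  have hsplit := Finset.sum_filter_add_sum_filter_not Finset.univ (fun u => f u < f v) d
  have hle := Finset.sum_le_sum_of_subset_of_nonneg hset fun u _ _ => hd0 u
  exact absurd (hmin w (Finset.mem_filter.2 ⟨Finset.mem_univ _, by linarith⟩)) (not_le.2 hwv)

/-- Cheeger's inequality for functions of weighted mean zero. -/
theorem cheeger_of_sum_eq_zero (hφ : 0 ≤ φ) (ha : ∀ u w, a u w = a w u)
    (hpos : ∀ u w, 0 ≤ a u w) (hd : ∀ u, d u = ∑ w, a u w)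
    (hcut : ∀ S : Finset V, ∑ u ∈ S, d u ≤ (∑ u, d u) / 2 →
      φ * ∑ u ∈ S, d u ≤ ∑ u ∈ S, ∑ w ∈ Sᶜ, a u w)
    (f : V → ℝ) (hf : ∑ u, d u * f u = 0) :
    φ ^ 2 * ∑ u, d u * f u ^ 2 ≤ ∑ u, ∑ w, a u w * (f u - f w) ^ 2 := by
  cases isEmpty_or_nonempty V
  · simp
  have hd0 : ∀ u, 0 ≤ d u := fun u => by
    rw [hd]; exact Finset.sum_nonneg fun w _ => hpos u w
  obtain ⟨c, hc₁, hc₂⟩ := exists_weighted_median hd0 f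
  have hp := cheeger_of_nonneg hφ ha hpos hd hcut (fun u => max (f u - c) 0)
    (fun u => le_max_right _ _) (by simpa using hc₁)
  have hm := cheeger_of_nonneg hφ ha hpos hd hcut (fun u => max (c - f u) 0)
    (fun u => le_max_right _ _) (by simpa using hc₂)
  have hE : ∑ u, ∑ w, a u w * (max (f u - c) 0 - max (f w - c) 0) ^ 2
      + ∑ u, ∑ w, a u w * (max (c - f u) 0 - max (c - f w) 0) ^ 2
      ≤ ∑ u, ∑ w, a u w * (f u - f w) ^ 2 := by
    simp only [← Finset.sum_add_distrib, ← mul_add]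
    refine Finset.sum_le_sum fun u _ => Finset.sum_le_sum fun w _ =>
      mul_le_mul_of_nonneg_left ?_ (hpos u w)
    rcases le_total (f u) c with hu | hu <;> rcases le_total (f w) c with hw | hw <;>
      simp only [max_eq_left, max_eq_right, sub_nonneg, sub_nonpos, hu, hw] <;>
      nlinarith [mul_nonneg (sub_nonneg.2 hu) (sub_nonneg.2 hw)]
  have hN : ∑ u, d u * f u ^ 2 ≤ ∑ u, d u * max (f u - c) 0 ^ 2
      + ∑ u, d u * max (c - f u) 0 ^ 2 := by
    have h1 : ∑ u, d u * max (f u - c) 0 ^ 2 + ∑ u, d u * max (c - f u) 0 ^ 2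
        = ∑ u, d u * f u ^ 2 - 2 * c * ∑ u, d u * f u + c ^ 2 * ∑ u, d u := by
      simp only [Finset.mul_sum, ← Finset.sum_add_distrib, ← Finset.sum_sub_distrib]
      refine Finset.sum_congr rfl fun u _ => ?_
      rcases le_total (f u) c with hu | hu <;>
        simp only [max_eq_left, max_eq_right, sub_nonneg, sub_nonpos, hu] <;> ring
    rw [h1, hf]
    have := mul_nonneg (sq_nonneg c) (Finset.sum_nonneg fun u (_ : u ∈ Finset.univ) => hd0 u)
    linarith
  nlinarith [mul_le_mul_of_nonneg_left hN (sq_nonneg φ)]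

/-- One step of the lazy walk contracts functions of weighted mean zero. -/
theorem lazy_step_contraction (hφ : 0 ≤ φ) (ha : ∀ u w, a u w = a w u)
    (hpos : ∀ u w, 0 ≤ a u w) (hd : ∀ u, d u = ∑ w, a u w)
    (hcut : ∀ S : Finset V, ∑ u ∈ S, d u ≤ (∑ u, d u) / 2 →
      φ * ∑ u ∈ S, d u ≤ ∑ u ∈ S, ∑ w ∈ Sᶜ, a u w)
    (f g : V → ℝ) (hf : ∑ u, d u * f u = 0) (hg : ∑ u, d u * g u = 0)
    (hfg : ∀ u, 2 * (d u * g u) = d u * f u + ∑ w, a u w * f w) :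
    ∑ u, d u * g u ^ 2 ≤ (1 - φ ^ 2 / 4) ^ 2 * ∑ u, d u * f u ^ 2 := by
  have hd0 : ∀ u, 0 ≤ d u := fun u => by
    rw [hd]; exact Finset.sum_nonneg fun w _ => hpos u w
  have hform : ∀ h : V → ℝ, ∑ u, d u * h u = 0 →
      ∑ u, ∑ w, a u w * (h u + h w) ^ 2 ≤ 4 * ((1 - φ ^ 2 / 4) * ∑ u, d u * h u ^ 2) := by
    intro h hh
    have h1 := cheeger_of_sum_eq_zero hφ ha hpos hd hcut h hh
    have h2 := sum_weight_sub_sq ha hd h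
    linarith
  have hnn : ∀ h : V → ℝ, 0 ≤ ∑ u, ∑ w, a u w * (h u + h w) ^ 2 := fun h =>
    Finset.sum_nonneg fun u _ => Finset.sum_nonneg fun w _ =>
      mul_nonneg (hpos u w) (sq_nonneg _)
  have hfg' : ∑ u, ∑ w, a u w * ((f u + f w) * (g u + g w)) = 4 * ∑ u, d u * g u ^ 2 := by
    rw [sum_weight_add_mul_add ha hd, ← sum_weight_mul_cross_comm ha]
    simp only [Finset.mul_sum, ← Finset.sum_add_distrib]
    refine Finset.sum_congr rfl fun u _ => ?_
    have h := congrArg (fun x => 2 * g u * x) (hfg u)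
    simp only [mul_add, Finset.mul_sum] at h
    have e : ∑ w, 2 * (a u w * (f w * g u)) = ∑ w, 2 * g u * (a u w * f w) :=
      Finset.sum_congr rfl fun w _ => by ring
    rw [e]
    linarith
  have hCS := sq_sum_weight_mul_le hpos (fun u w => f u + f w) (fun u w => g u + g w)
  rw [hfg'] at hCS
  have hprod := mul_le_mul (hform f hf) (hform g hg) (hnn g) ((hnn f).trans (hform f hf))
  have hF : 0 ≤ ∑ u, d u * f u ^ 2 :=
    Finset.sum_nonneg fun u _ => mul_nonneg (hd0 u) (sq_nonneg _)
  have hG : 0 ≤ ∑ u, d u * g u ^ 2 :=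
    Finset.sum_nonneg fun u _ => mul_nonneg (hd0 u) (sq_nonneg _)
  rcases hG.eq_or_lt with h0 | h0
  · rw [← h0]; positivity
  · refine le_of_mul_le_mul_right ?_ h0
    linarith [hCS.trans hprod]

end WeightedGraph

theorem deg_eq_sum_adjMat [Fintype V] (G : SimpleGraph V) (v : V) :
    deg G v = ∑ u, adjMat G v u := by
  simp [deg, adjMat]

theorem adjMat_comm [Fintype V] (G : SimpleGraph V) (u v : V) :
    adjMat G u v = adjMat G v u := by
  simp [adjMat, G.adj_comm]

theorem adjMat_nonneg [Fintype V] (G : SimpleGraph V) (u v : V) : 0 ≤ adjMat G u v := by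
  simp only [adjMat, Matrix.of_apply]
  split_ifs <;> norm_num

theorem eB_eq_sum_adjMat [Fintype V] (G : SimpleGraph V) (S : Finset V) :
    eB G S (S : Set V)ᶜ = ∑ u ∈ S, ∑ w ∈ Sᶜ, adjMat G u w := by
  simp only [adjMat, Matrix.of_apply]
  rw [← Finset.sum_product', Finset.sum_boole, eB]
  congr 2
  ext p
  simp [and_assoc]

theorem mul_vol_le_cut [Fintype V] (G : SimpleGraph V) (hdeg : ∀ v, 1 ≤ deg G v) {φ : ℝ}
    (hcond : φ ≤ conductance G) (S : Finset V)
    (hS : ∑ u ∈ S, deg G u ≤ (∑ u, deg G u) / 2) :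
    φ * ∑ u ∈ S, deg G u ≤ ∑ u ∈ S, ∑ w ∈ Sᶜ, adjMat G u w := by
  rcases S.eq_empty_or_nonempty with rfl | hne
  · simp
  have hvol : vol G (S : Set V) = ∑ u ∈ S, deg G u := by simp [vol]
  have hpos : 0 < ∑ u ∈ S, deg G u :=
    Finset.sum_pos (fun u _ => one_pos.trans_le (hdeg u)) hne
  have hbdd : BddBelow {x | ∃ S : Set V, S.Nonempty ∧
      vol G S ≤ vol G Set.univ / 2 ∧ x = cond G S} := by
    refine ⟨0, ?_⟩
    rintro _ ⟨T, -, -, rfl⟩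
    exact div_nonneg (Nat.cast_nonneg _) (Finset.sum_nonneg fun u _ => Nat.cast_nonneg _)
  have h : φ ≤ cond G (S : Set V) :=
    hcond.trans (csInf_le hbdd ⟨S, by simpa using hne, by simpa [vol] using hS, rfl⟩)
  rw [cond, hvol, le_div_iff₀ hpos] at h
  rwa [← eB_eq_sum_adjMat]

theorem two_mul_vecMul_lazyW [Fintype V] [DecidableEq V] (G : SimpleGraph V) (p : V → ℝ)
    (u : V) : 2 * (p ᵥ* lazyW G) u = p u + ∑ w, adjMat G u w * (p w / deg G w) := by
  have h : (p ᵥ* (degInv G * adjMat G)) u = ∑ w, adjMat G u w * (p w / deg G w) := by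
    rw [← Matrix.vecMul_vecMul]
    simp only [Matrix.vecMul, dotProduct, degInv, Matrix.diagonal_apply]
    refine Finset.sum_congr rfl fun w _ => ?_
    simp [adjMat_comm G u w, div_eq_mul_inv, mul_comm]
  rw [lazyW, Matrix.vecMul_smul, Matrix.vecMul_add, Matrix.vecMul_one, Pi.smul_apply,
    Pi.add_apply, h, smul_eq_mul]
  ring

theorem sum_vecMul_lazyW [Fintype V] [DecidableEq V] (G : SimpleGraph V)
    (hdeg : ∀ v, 1 ≤ deg G v) (p : V → ℝ) : ∑ u, (p ᵥ* lazyW G) u = ∑ u, p u := by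
  have h : ∑ u, 2 * (p ᵥ* lazyW G) u = ∑ u, 2 * p u := by
    simp only [two_mul_vecMul_lazyW, Finset.sum_add_distrib, two_mul (p _)]
    congr 1
    rw [Finset.sum_comm]
    refine Finset.sum_congr rfl fun w _ => ?_
    rw [← Finset.sum_mul]
    simp only [fun u => adjMat_comm G u w]
    rw [← deg_eq_sum_adjMat, mul_div_cancel₀ _ (one_pos.trans_le (hdeg w)).ne']
  rw [← Finset.mul_sum, ← Finset.mul_sum] at h
  linarith

theorem sum_vecMul_lazyW_pow [Fintype V] [DecidableEq V] (G : SimpleGraph V)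
    (hdeg : ∀ v, 1 ≤ deg G v) (p : V → ℝ) (t : ℕ) :
    ∑ u, (p ᵥ* lazyW G ^ t) u = ∑ u, p u := by
  induction t with
  | zero => simp
  | succ t ih => rw [pow_succ, ← Matrix.vecMul_vecMul, sum_vecMul_lazyW G hdeg, ih]

theorem sum_deg_mul_sub_sq [Fintype V] (G : SimpleGraph V) (hdeg : ∀ v, 1 ≤ deg G v)
    (hvol : vol G Set.univ ≠ 0) (p : V → ℝ) (hp : ∑ u, p u = 1) :
    ∑ u, deg G u * (p u / deg G u - 1 / vol G Set.univ) ^ 2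
      = ∑ u, p u ^ 2 / deg G u - 1 / vol G Set.univ := by
  have hterm : ∀ u, deg G u * (p u / deg G u - 1 / vol G Set.univ) ^ 2
      = p u ^ 2 / deg G u - 2 / vol G Set.univ * p u
        + (1 / vol G Set.univ) ^ 2 * deg G u := fun u => by
    have := (one_pos.trans_le (hdeg u)).ne'
    field_simp
    ring
  have hsum : ∑ u, deg G u = vol G Set.univ := by simp [vol]
  simp only [hterm, Finset.sum_add_distrib, Finset.sum_sub_distrib, ← Finset.mul_sum, hp, hsum]
  field_simp
  ring

/-- The weighted variance of the density of the lazy walk decays geometrically. -/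
theorem lazy_walk_variance_le [Fintype V] [DecidableEq V] (G : SimpleGraph V)
    (hdeg : ∀ v, 1 ≤ deg G v) {φ : ℝ} (hφ : 0 ≤ φ) (hcond : φ ≤ conductance G)
    (hvol : vol G Set.univ ≠ 0) (p : V → ℝ) (hp : ∑ u, p u = 1) (t : ℕ) :
    ∑ u, deg G u * ((p ᵥ* lazyW G ^ t) u / deg G u - 1 / vol G Set.univ) ^ 2
      ≤ ((1 - φ ^ 2 / 4) ^ 2) ^ t
        * ∑ u, deg G u * (p u / deg G u - 1 / vol G Set.univ) ^ 2 := by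
  have hd0 : ∀ u, deg G u ≠ 0 := fun u => (one_pos.trans_le (hdeg u)).ne'
  have hsum : ∑ u, deg G u = vol G Set.univ := by simp [vol]
  have hmean : ∀ q : V → ℝ, ∑ u, q u = 1 →
      ∑ u, deg G u * (q u / deg G u - 1 / vol G Set.univ) = 0 := fun q hq => by
    simp only [mul_sub, mul_div_cancel₀ _ (hd0 _), Finset.sum_sub_distrib, ← Finset.sum_mul,
      hq, hsum]
    field_simp
    ring
  induction t with
  | zero => simp
  | succ t ih =>
    set q := p ᵥ* lazyW G ^ t with hq
    have hq1 : ∑ u, q u = 1 := by rw [hq, sum_vecMul_lazyW_pow G hdeg, hp]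
    rw [pow_succ (lazyW G), ← Matrix.vecMul_vecMul, ← hq]
    refine (lazy_step_contraction hφ (adjMat_comm G) (adjMat_nonneg G) (deg_eq_sum_adjMat G)
      (mul_vol_le_cut G hdeg hcond) (fun u => q u / deg G u - 1 / vol G Set.univ) _
      (hmean q hq1) (hmean _ (by rw [sum_vecMul_lazyW G hdeg, hq1])) fun u => ?_).trans ?_
    · simp only [mul_sub, mul_div_cancel₀ _ (hd0 _), two_mul_vecMul_lazyW,
        Finset.sum_sub_distrib, ← Finset.sum_mul, ← deg_eq_sum_adjMat]
      ring
    · rw [pow_succ' ((1 - φ ^ 2 / 4) ^ 2) t, mul_assoc]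
      exact mul_le_mul_of_nonneg_left ih (sq_nonneg _)

/-- If every vertex of `G` has degree at least 1 and the conductance
of `G` is at least `φ > 0`, then for every vertex `v` and every `t ≥ 0`, the row
vector `p_v^t = 1_v W^t` satisfies `‖p_v^t D^{-1/2}‖₂² ≤ 1/μ_G + (1 - φ²/4)^{2t}`. -/
theorem lazy_walk_l2_decay
    {V : Type*} [Fintype V] [DecidableEq V] (G : SimpleGraph V)
    (hdeg : ∀ v, 1 ≤ deg G v)
    (φ : ℝ) (hφ : 0 < φ) (hcond : φ ≤ conductance G)
    (v : V) (t : ℕ) :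
    ∑ u, ((indVec v ᵥ* (lazyW G ^ t) ᵥ* degInvSqrt G) u) ^ 2
      ≤ 1 / vol G Set.univ + (1 - φ ^ 2 / 4) ^ (2 * t) := by
  have hd0 : ∀ u, 0 < deg G u := fun u => one_pos.trans_le (hdeg u)
  have hvol : 0 < vol G Set.univ := by
    have : Nonempty V := ⟨v⟩
    simpa [vol] using Finset.sum_pos (fun u (_ : u ∈ Finset.univ) => hd0 u)
      Finset.univ_nonempty
  have hone : ∑ u, indVec v u = 1 := by
    rw [Finset.sum_eq_single v (fun u _ hu => by simp [indVec, hu]) (by simp)]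
    simp [indVec]
  have hlhs : ∑ u, ((indVec v ᵥ* (lazyW G ^ t) ᵥ* degInvSqrt G) u) ^ 2
      = ∑ u, (indVec v ᵥ* lazyW G ^ t) u ^ 2 / deg G u := by
    refine Finset.sum_congr rfl fun u _ => ?_
    rw [degInvSqrt, Matrix.vecMul_diagonal, mul_pow, inv_pow, Real.sq_sqrt (hd0 u).le,
      div_eq_mul_inv]
  have hdecay := lazy_walk_variance_le G hdeg hφ.le hcond hvol.ne' (indVec v) hone t
  rw [sum_deg_mul_sub_sq G hdeg hvol.ne' _ (by rw [sum_vecMul_lazyW_pow G hdeg, hone]),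
    sum_deg_mul_sub_sq G hdeg hvol.ne' _ hone, ← pow_mul] at hdecay
  have hstart : ∑ u, indVec v u ^ 2 / deg G u - 1 / vol G Set.univ ≤ 1 := by
    have h1 : ∑ u, indVec v u ^ 2 / deg G u = 1 / deg G v := by
      rw [Finset.sum_eq_single v (fun u _ hu => by simp [indVec, hu]) (by simp)]
      simp [indVec]
    have h2 : 1 / deg G v ≤ 1 := (div_le_one (hd0 v)).2 (hdeg v)
    have h3 : 0 < 1 / vol G Set.univ := one_div_pos.2 hvol
    linarith
  have hpow : 0 ≤ (1 - φ ^ 2 / 4) ^ (2 * t) := by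
    rw [pow_mul]; exact pow_nonneg (sq_nonneg _) t
  rw [hlhs]
  linarith [mul_le_mul_of_nonneg_left hstart hpow]

end Sublinear
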